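/- arXiv:2002.10700 — 2 statements merged into one kernel-verified Lean document; each statement's English description precedes it below -/
import Mathlib

section
/- Let k be a field and 𝒞 a k-linear abelian category with enough projectives in which every object admits a finite projective resolution. Let E be a d-spherelike object of D^b(𝒞) with distinguished degree-d endomorphism x spanning Hom^d(E,E) (modulo k·id when d = 0). If for every projective object P of 𝒞 (viewed as a complex concentrated in a single degree) and every i ∈ ℤ the composition pairing Hom^i(P,E) ⊗ Hom^{d−i}(E,P) → Hom^d(E,E) → k·x is non-degenerate, then for every object F of D^b(𝒞) and every i ∈ ℤ the composition pairing Hom^i(F,E) ⊗ Hom^{d−i}(E,F) → Hom^d(E,E) → k·x is non-degenerate. -/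
/-!
**Statement 1.**  Let `k` be a field and `𝒞` a `k`-linear abelian category with
enough projectives in which every object admits a finite projective resolution.
Let `E` be a `d`-spherelike object of `D^b(𝒞)` (realized as `E = Q.obj KE` for a
bounded cochain complex `KE`), with distinguished degree-`d` endomorphism `x`
spanning `Hom^d(E, E)` (modulo `k·id` when `d = 0`), the coefficient of `x` being
given by the functional `πx`.  If for every projective object `P` of `𝒞` (viewed
as a complex concentrated in a single degree) and every `i ∈ ℤ` the composition
pairing `Hom^i(P, E) ⊗ Hom^{d-i}(E, P) → Hom^d(E, E) → k·x` is non-degenerate,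
then the same holds for every object `F` of `D^b(𝒞)`.

Scalars from `k` act on morphisms out of `Q.obj K` by `sc`, i.e. by precomposing
with the image of `c • 𝟙 K`; "non-degenerate" means that the induced map
`Hom^i(F, E) → (Hom^{d-i}(E, F))*` into the dual space is bijective, which is
spelled out in `PairingNondeg` (injectivity, and surjectivity onto all
`k`-linear functionals).
-/

noncomputable section
open CategoryTheory Category Limits DerivedCategory

namespace SphericalStmt1

variable {k : Type*} [Field k] {C : Type*} [Category C] [Abelian C]
  [CategoryTheory.Linear k C] [HasDerivedCategory C]

/-- The action of a scalar `c : k` on morphisms out of `Q.obj K` in the derived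
category, given by precomposition with the image of `c • 𝟙 K`. -/
def sc (c : k) {K : CochainComplex C ℤ} {Y : DerivedCategory C}
    (f : DerivedCategory.Q.obj K ⟶ Y) : DerivedCategory.Q.obj K ⟶ Y :=
  DerivedCategory.Q.map (c • 𝟙 K) ≫ f

/-- The composition pairing
`Hom^i(F, E) ⊗ Hom^{d-i}(E, F) → Hom^d(E, E)`, `(f, g) ↦ g[i] ∘ f`. -/
def pair {E F : DerivedCategory C} (d i : ℤ) (f : F ⟶ E⟦i⟧) (g : E ⟶ F⟦d - i⟧) :
    E ⟶ E⟦d⟧ :=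
  g ≫ (shiftFunctor (DerivedCategory C) (d - i)).map f ≫
    ((shiftFunctorAdd' (DerivedCategory C) i (d - i) d (by ring)).inv.app E)

/-- The morphism `E ⟶ E⟦d⟧` corresponding to the identity if `d = 0`,
and `0` otherwise. -/
def idShift (E : DerivedCategory C) (d : ℤ) : E ⟶ E⟦d⟧ :=
  if h : d = 0 then
    (by subst h; exact (shiftFunctorZero (DerivedCategory C) ℤ).inv.app E)
  else 0

/-- A cochain complex is (strictly) bounded. -/
def IsBddComplex (K : CochainComplex C ℤ) : Prop :=
  ∃ p q : ℤ, ∀ i : ℤ, (i < p ∨ q < i) → IsZero (K.X i)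

variable (k) in
/-- Non-degeneracy of the composition pairing
`Hom^i(F, E) ⊗ Hom^{d-i}(E, F) → Hom^d(E, E) → k·x` for `E = Q.obj KE` and
`F = Q.obj K` and all `i ∈ ℤ`, where `πx` extracts the `x`-coefficient:
the induced map `Hom^i(F, E) → (Hom^{d-i}(E, F))*` is bijective, i.e. it is
injective and every `k`-linear functional is induced by some `f`. -/
def PairingNondeg (KE : CochainComplex C ℤ) (d : ℤ)
    (πx : (DerivedCategory.Q.obj KE ⟶ (DerivedCategory.Q.obj KE)⟦d⟧) → k)
    (K : CochainComplex C ℤ) : Prop :=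
  ∀ i : ℤ,
    (∀ f : DerivedCategory.Q.obj K ⟶ (DerivedCategory.Q.obj KE)⟦i⟧,
      (∀ g : DerivedCategory.Q.obj KE ⟶ (DerivedCategory.Q.obj K)⟦d - i⟧,
        πx (pair d i f g) = 0) → f = 0) ∧
    (∀ l : (DerivedCategory.Q.obj KE ⟶ (DerivedCategory.Q.obj K)⟦d - i⟧) → k,
      (∀ g g', l (g + g') = l g + l g') →
      (∀ (c : k) g, l (sc c g) = c * l g) →
      ∃ f : DerivedCategory.Q.obj K ⟶ (DerivedCategory.Q.obj KE)⟦i⟧,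
        ∀ g, πx (pair d i f g) = l g)

section General

open Pretriangulated

variable {𝕜 : Type*} [Field 𝕜] {D : Type*} [Category D] [Preadditive D]
  [CategoryTheory.Linear 𝕜 D] [HasZeroObject D] [HasShift D ℤ]
  [∀ n : ℤ, (shiftFunctor D n).Additive] [Pretriangulated D]

/-- general pairing -/
def gpair {E F : D} (i m d : ℤ) (h : i + m = d) (f : F ⟶ E⟦i⟧) (g : E ⟶ F⟦m⟧) : E ⟶ E⟦d⟧ :=
  g ≫ (shiftFunctor D m).map f ≫ (shiftFunctorAdd' D i m d h).inv.app E

/-- general nondegeneracy in one degree -/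
def Nd {E : D} (d : ℤ) (τ : (E ⟶ E⟦d⟧) →ₗ[𝕜] 𝕜) (F : D) (i m : ℤ) (h : i + m = d) : Prop :=
  (∀ f : F ⟶ E⟦i⟧, (∀ g : E ⟶ F⟦m⟧, τ (gpair i m d h f g) = 0) → f = 0) ∧
  (∀ l : (E ⟶ F⟦m⟧) →ₗ[𝕜] 𝕜, ∃ f : F ⟶ E⟦i⟧, ∀ g, τ (gpair i m d h f g) = l g)

variable {E : D} {d : ℤ}

lemma gpair_nat {F F' : D} (i m : ℤ) (h : i + m = d) (a : F ⟶ F') (f : F' ⟶ E⟦i⟧)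
    (g : E ⟶ F⟦m⟧) : gpair i m d h (a ≫ f) g = gpair i m d h f (g ≫ a⟦m⟧') := by
  simp [gpair]

lemma gpair_add_left {F : D} (i m : ℤ) (h : i + m = d) (f f' : F ⟶ E⟦i⟧)
    (g : E ⟶ F⟦m⟧) :
    gpair i m d h (f + f') g = gpair i m d h f g + gpair i m d h f' g := by
  simp [gpair, Functor.map_add]

lemma gpair_sub_left {F : D} (i m : ℤ) (h : i + m = d) (f f' : F ⟶ E⟦i⟧)
    (g : E ⟶ F⟦m⟧) :
    gpair i m d h (f - f') g = gpair i m d h f g - gpair i m d h f' g := by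
  simp [gpair, Functor.map_sub]

/-- pairing as linear functional -/
def gfun (τ : (E ⟶ E⟦d⟧) →ₗ[𝕜] 𝕜) {F : D} (i m : ℤ) (h : i + m = d) (f : F ⟶ E⟦i⟧) :
    (E ⟶ F⟦m⟧) →ₗ[𝕜] 𝕜 :=
  τ.comp (Linear.rightComp 𝕜 E
    ((shiftFunctor D m).map f ≫ (shiftFunctorAdd' D i m d h).inv.app E))

lemma gfun_apply (τ : (E ⟶ E⟦d⟧) →ₗ[𝕜] 𝕜) {F : D} (i m : ℤ) (h : i + m = d) (f : F ⟶ E⟦i⟧)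
    (g) : gfun τ i m h f g = τ (gpair i m d h f g) := rfl

lemma factor_dual {V W : Type*} [AddCommGroup V] [Module 𝕜 V] [AddCommGroup W] [Module 𝕜 W]
    (φ : V →ₗ[𝕜] W) (l : V →ₗ[𝕜] 𝕜) (h : ∀ v, φ v = 0 → l v = 0) :
    ∃ l' : W →ₗ[𝕜] 𝕜, ∀ v, l' (φ v) = l v := by
  have : l ∈ LinearMap.range φ.dualMap := by
    rw [LinearMap.range_dualMap_eq_dualAnnihilator_ker, Submodule.mem_dualAnnihilator]
    intro v hv
    exact h v hv
  obtain ⟨l', rfl⟩ := this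
  exact ⟨l', fun v => rfl⟩

lemma Nd.of_iso {τ : (E ⟶ E⟦d⟧) →ₗ[𝕜] 𝕜} {F F' : D} {i m : ℤ} {h : i + m = d}
    (H : Nd d τ F i m h) (e : F ≅ F') : Nd d τ F' i m h := by
  refine ⟨fun f hf => ?_, fun l => ?_⟩
  · have := H.1 (e.hom ≫ f) (fun g => by rw [gpair_nat]; exact hf _)
    rw [← cancel_epi e.hom, this, comp_zero]
  · obtain ⟨f, hf⟩ := H.2 (l.comp (Linear.rightComp 𝕜 E (e.hom⟦m⟧')))
    refine ⟨e.inv ≫ f, fun g => ?_⟩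
    rw [gpair_nat, hf]
    simp [← Functor.map_comp]

lemma Nd.shift {τ : (E ⟶ E⟦d⟧) →ₗ[𝕜] 𝕜} {F : D} {j m' : ℤ} {h' : j + m' = d}
    (H : Nd d τ F j m' h') (n i m : ℤ) (h : i + m = d) (hj : j + n = i) :
    Nd d τ (F⟦n⟧) i m h := by
  have hnm : n + m = m' := by omega
  have key : ∀ (f : F ⟶ E⟦j⟧) (g : E ⟶ F⟦n⟧⟦m⟧),
      gpair i m d h (f⟦n⟧' ≫ (shiftFunctorAdd' D j n i hj).inv.app E) g =
      gpair j m' d h' f (g ≫ (shiftFunctorAdd' D n m m' hnm).inv.app F) := by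
    intro f g
    have e1 := shiftFunctorAdd'_assoc_inv_app (C := D) j n m i m' d hj hnm (by omega) E
    have e2 := (shiftFunctorAdd' D n m m' hnm).inv.naturality f
    dsimp at e2
    simp only [gpair, Functor.map_comp, assoc]
    rw [e1, ← reassoc_of% e2]
  have surj : ∀ f : F⟦n⟧ ⟶ E⟦i⟧, ∃ f' : F ⟶ E⟦j⟧,
      f = f'⟦n⟧' ≫ (shiftFunctorAdd' D j n i hj).inv.app E := by
    intro f
    obtain ⟨f', hf'⟩ := (shiftFunctor D n).map_surjective
      (f ≫ (shiftFunctorAdd' D j n i hj).hom.app E)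
    exact ⟨f', by rw [hf']; simp⟩
  refine ⟨fun f hf => ?_, fun l => ?_⟩
  · obtain ⟨f', rfl⟩ := surj f
    have : f' = 0 := H.1 f' (fun g => by
      have := hf (g ≫ (shiftFunctorAdd' D n m m' hnm).hom.app F)
      rw [key] at this
      simpa using this)
    rw [this]; simp
  · obtain ⟨f, hf⟩ := H.2 (l.comp (Linear.rightComp 𝕜 E
      ((shiftFunctorAdd' D n m m' hnm).hom.app F)))
    refine ⟨f⟦n⟧' ≫ (shiftFunctorAdd' D j n i hj).inv.app E, fun g => ?_⟩
    rw [key, hf]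
    simp

lemma Nd.of_triangle {τ : (E ⟶ E⟦d⟧) →ₗ[𝕜] 𝕜} (T : Triangle D) (hT : T ∈ distTriang D)
    {i m : ℤ} {h : i + m = d}
    (H1 : Nd d τ T.obj₁ i m h) (H1' : Nd d τ (T.obj₁⟦(1 : ℤ)⟧) i m h)
    (H3 : Nd d τ T.obj₃ i m h) (H3' : Nd d τ (T.obj₃⟦(-1 : ℤ)⟧) i m h) :
    Nd d τ T.obj₂ i m h := by
  have ex : ∀ {A B X : D} (a : A ⟶ B) (b : B ⟶ X) (_ : ∃ c, Triangle.mk a b c ∈ distTriang D)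
      (g : E ⟶ B⟦m⟧), g ≫ b⟦m⟧' = 0 → ∃ g' : E ⟶ A⟦m⟧, g = g' ≫ a⟦m⟧' := by
    rintro A B X a b ⟨c, hc⟩ g hg
    have hs := Triangle.shift_distinguished _ hc m
    obtain ⟨g', hg'⟩ := Triangle.coyoneda_exact₂ _ hs (X := E) g (by
      change g ≫ (m.negOnePow • b⟦m⟧') = 0
      rcases Int.units_eq_one_or m.negOnePow with e | e <;> rw [e] <;> simp [hg])
    change E ⟶ A⟦m⟧ at g'
    change g = g' ≫ (m.negOnePow • a⟦m⟧') at hg'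
    refine ⟨m.negOnePow • g', ?_⟩
    rw [hg']
    rcases Int.units_eq_one_or m.negOnePow with e | e <;> rw [e] <;> simp
  have ex2 := ex T.mor₁ T.mor₂ ⟨T.mor₃, hT⟩
  have ex3 := ex T.mor₂ T.mor₃ ⟨_, rot_of_distTriang _ hT⟩
  refine ⟨fun f hf => ?_, fun l => ?_⟩
  · have h1 : T.mor₁ ≫ f = 0 := H1.1 _ (fun g => by rw [gpair_nat]; exact hf _)
    obtain ⟨f3, rfl⟩ := Triangle.yoneda_exact₂ T hT f h1
    obtain ⟨l, hl⟩ := factor_dual (Linear.rightComp 𝕜 E (T.mor₃⟦m⟧')) (gfun τ i m h f3) (by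
      intro g hg
      obtain ⟨g', rfl⟩ := ex3 g hg
      rw [gfun_apply, ← gpair_nat]
      exact hf _)
    obtain ⟨u, hu⟩ := H1'.2 l
    have : f3 - T.mor₃ ≫ u = 0 := H3.1 _ (fun g => by
      rw [gpair_sub_left, map_sub, gpair_nat, hu, ← gfun_apply, ← hl]
      simp)
    rw [sub_eq_zero.1 this, ← assoc, comp_distTriang_mor_zero₂₃ _ hT, zero_comp]
  · obtain ⟨f1, hf1⟩ := H1.2 (l.comp (Linear.rightComp 𝕜 E (T.mor₁⟦m⟧')))
    obtain ⟨w, c, hT'⟩ : ∃ (w : T.obj₃⟦(-1 : ℤ)⟧ ⟶ T.obj₁) (c : _ ⟶ _),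
        Triangle.mk w T.mor₁ c ∈ distTriang D := ⟨_, _, inv_rot_of_distTriang _ hT⟩
    have hw : w ≫ T.mor₁ = 0 := comp_distTriang_mor_zero₁₂ _ hT'
    have z : w ≫ f1 = 0 := H3'.1 _ (fun g => by
      rw [gpair_nat, hf1]
      simp only [LinearMap.comp_apply, Linear.rightComp_apply, assoc, ← Functor.map_comp]
      rw [hw]; simp)
    obtain ⟨f2, hf2⟩ : ∃ f2 : T.obj₂ ⟶ _, f1 = T.mor₁ ≫ f2 :=
      Triangle.yoneda_exact₂ _ hT' f1 z
    subst hf2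
    obtain ⟨l3, hl3⟩ := factor_dual (Linear.rightComp 𝕜 E (T.mor₂⟦m⟧')) (l - gfun τ i m h f2) (by
      intro g hg
      obtain ⟨g', rfl⟩ := ex2 g hg
      have := hf1 g'
      rw [gpair_nat] at this
      rw [LinearMap.sub_apply, gfun_apply, this]
      simp)
    obtain ⟨f3, hf3⟩ := H3.2 l3
    refine ⟨f2 + T.mor₂ ≫ f3, fun g => ?_⟩
    rw [gpair_add_left, map_add, gpair_nat, hf3]
    have := hl3 g
    rw [LinearMap.sub_apply, gfun_apply] at this
    simp only [Linear.rightComp_apply] at this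
    rw [this]; ring

end General

section Dev

variable {KE : CochainComplex C ℤ} {d : ℤ}
  {τ : (DerivedCategory.Q.obj KE ⟶ (DerivedCategory.Q.obj KE)⟦d⟧) →ₗ[k] k}

/-- all degrees -/
def NdAll (τ : (DerivedCategory.Q.obj KE ⟶ (DerivedCategory.Q.obj KE)⟦d⟧) →ₗ[k] k)
    (F : DerivedCategory C) : Prop :=
  ∀ i m h, Nd d τ F i m h

lemma sc_eq_smul (c : k) {K : CochainComplex C ℤ} {Y : DerivedCategory C}
    (f : DerivedCategory.Q.obj K ⟶ Y) : sc c f = c • f := by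
  simp [sc, Functor.map_smul]

lemma ndAll_iff (K : CochainComplex C ℤ) :
    PairingNondeg k KE d τ K ↔ NdAll τ (DerivedCategory.Q.obj K) := by
  constructor
  · intro H i m h
    obtain rfl : m = d - i := by omega
    refine ⟨(H i).1, fun l => (H i).2 l (by simp) (by simp [sc_eq_smul])⟩
  · intro H i
    refine ⟨(H i (d - i) (by omega)).1, fun l h1 h2 => ?_⟩
    exact (H i (d - i) (by omega)).2
      { toFun := l, map_add' := h1, map_smul' := fun c g => by
          rw [← sc_eq_smul, h2]; rfl }

lemma NdAll.of_iso {F F' : DerivedCategory C} (H : NdAll τ F) (e : F ≅ F') : NdAll τ F' :=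
  fun i m h => (H i m h).of_iso e

lemma NdAll.shift {F : DerivedCategory C} (H : NdAll τ F) (n : ℤ) : NdAll τ (F⟦n⟧) :=
  fun i m h => (H (i - n) (m + n) (by omega)).shift n i m h (by omega)

lemma NdAll.of_ses (S : ShortComplex (CochainComplex C ℤ)) (hS : S.ShortExact)
    (H1 : NdAll τ (DerivedCategory.Q.obj S.X₁)) (H3 : NdAll τ (DerivedCategory.Q.obj S.X₃)) :
    NdAll τ (DerivedCategory.Q.obj S.X₂) := fun i m h =>
  Nd.of_triangle _ (triangleOfSES_distinguished hS) (H1 i m h) (H1.shift 1 i m h)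
    (H3 i m h) (H3.shift (-1) i m h)

lemma NdAll.single {X : C} (H : NdAll τ ((singleFunctor C 0).obj X)) (q : ℤ) :
    NdAll τ ((singleFunctor C q).obj X) :=
  (H.shift (-q)).of_iso (((singleFunctors C).shiftIso (-q) q 0 (by omega)).app X)

lemma NdAll.of_isZero {F : DerivedCategory C} (hF : IsZero F) : NdAll τ F := by
  intro i m h
  refine ⟨fun f _ => hF.eq_of_src _ _, fun l => ⟨0, fun g => ?_⟩⟩
  have : g = 0 := (Functor.map_isZero (shiftFunctor _ m) hF).eq_of_tgt _ _
  subst this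
  simp [gpair]

lemma ndAll_of_bdd (n : ℕ) : ∀ (p q : ℤ) (K : CochainComplex C ℤ), q - p + 1 ≤ n →
    (∀ i : ℤ, (i < p ∨ q < i) → IsZero (K.X i)) →
    (∀ i, NdAll τ ((singleFunctor C 0).obj (K.X i))) →
    NdAll τ (DerivedCategory.Q.obj K) := by
  induction n with
  | zero =>
    intro p q K hpq hK _
    apply NdAll.of_isZero
    apply Functor.map_isZero
    rw [IsZero.iff_id_eq_zero]
    ext i
    exact (hK i (by push_cast at hpq; omega)).eq_of_src _ _
  | succ n ih =>
    intro p q K hpq hK hX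
    let φ : (HomologicalComplex.single C (ComplexShape.up ℤ) q).obj (K.X q) ⟶ K :=
      HomologicalComplex.mkHomFromSingle (𝟙 _) (fun j hj =>
        (hK j (by simp at hj; omega)).eq_of_tgt _ _)
    have hφq : IsIso (φ.f q) := by
      dsimp only [φ]
      rw [HomologicalComplex.mkHomFromSingle_f]
      infer_instance
    have hφ : Mono φ := by
      apply (config := { allowSynthFailures := true }) HomologicalComplex.mono_of_mono_f
      intro i
      by_cases hi : i = q
      · subst hi; infer_instance
      · exact (HomologicalComplex.isZero_single_obj_X _ _ _ _ hi).mono _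
    have hS : (ShortComplex.mk φ (cokernel.π φ) (by simp)).ShortExact :=
      { exact := ShortComplex.exact_cokernel φ }
    have hSi := fun i => hS.map_of_exact (HomologicalComplex.eval C (ComplexShape.up ℤ) i)
    have hq : IsZero ((cokernel φ).X q) := by
      have := (hSi q).epi_g
      have e := (ShortComplex.mk φ (cokernel.π φ) (by simp)).zero
      have e' : φ.f q ≫ (cokernel.π φ).f q = 0 := by
        rw [← HomologicalComplex.comp_f, cokernel.condition]; rfl
      have e2 : (cokernel.π φ).f q = 0 := by
        rw [← cancel_epi (φ.f q), e', comp_zero]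
      have : Epi ((cokernel.π φ).f q) := this
      exact IsZero.of_epi_eq_zero _ e2
    have hne : ∀ i, i ≠ q → IsIso ((cokernel.π φ).f i) := by
      intro i hi
      have hz := HomologicalComplex.isZero_single_obj_X (ComplexShape.up ℤ) q (K.X q) i hi
      exact (hSi i).isIso_g_iff.2 hz
    apply NdAll.of_ses _ hS
    · exact (hX q).single q
    · refine ih p (q - 1) (cokernel φ) (by push_cast at hpq; omega) (fun i hi => ?_) (fun i => ?_)
      · by_cases h : i = q
        · subst h; exact hq
        · have := hne i h
          exact (hK i (by omega)).of_iso (asIso ((cokernel.π φ).f i)).symm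
      · by_cases h : i = q
        · subst h
          exact NdAll.of_isZero (Functor.map_isZero _ hq)
        · have := hne i h
          exact (hX i).of_iso ((singleFunctor C 0).mapIso (asIso ((cokernel.π φ).f i)))

lemma ndAll_single (hp : ∀ P : C, Projective P → NdAll τ ((singleFunctor C 0).obj P))
    {X : C} (pr : CategoryTheory.ProjectiveResolution X) (m : ℕ)
    (hm : ∀ l : ℕ, m ≤ l → IsZero (pr.complex.X l)) :
    NdAll τ ((singleFunctor C 0).obj X) := by
  have h := ndAll_of_bdd (τ := τ) (m + 1) (-m) 0 pr.cochainComplex (by push_cast; omega)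
    (fun i hi => by
      rcases hi with hi | hi
      · obtain ⟨l, rfl⟩ := Int.exists_eq_neg_ofNat (show i ≤ 0 by omega)
        exact (hm l (by omega)).of_iso (pr.cochainComplexXIso (-l) l)
      · exact CochainComplex.isZero_of_isStrictlyLE _ 0 _ hi)
    (fun i => hp _ inferInstance)
  have : IsIso (DerivedCategory.Q.map pr.π') := by
    rw [isIso_Q_map_iff_quasiIso]; infer_instance
  exact h.of_iso (@asIso _ _ _ _ (DerivedCategory.Q.map pr.π') this)

end Dev

theorem pairing_nondeg_of_nondeg_on_projectives
    [EnoughProjectives C]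
    -- every object admits a finite projective resolution:
    (hfindim : ∀ X : C, ∃ (pr : CategoryTheory.ProjectiveResolution X) (m : ℕ),
      ∀ l : ℕ, m ≤ l → IsZero (pr.complex.X l))
    (d : ℕ) (KE : CochainComplex C ℤ) (hKE : IsBddComplex KE)
    (x : DerivedCategory.Q.obj KE ⟶ (DerivedCategory.Q.obj KE)⟦(d : ℤ)⟧)
    (πx : (DerivedCategory.Q.obj KE ⟶ (DerivedCategory.Q.obj KE)⟦(d : ℤ)⟧) → k)
    -- `πx` is the linear functional giving the coefficient of `x`:
    (hπadd : ∀ φ ψ, πx (φ + ψ) = πx φ + πx ψ)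
    (hπsmul : ∀ (c : k) φ, πx (sc c φ) = c * πx φ)
    (hπx : πx x = 1)
    (hπid : πx (idShift (DerivedCategory.Q.obj KE) (d : ℤ)) = 0)
    -- (S1): `Hom^*(E, F)` and `Hom^*(F, E)` have finite total dimension:
    (hS1 : ∀ K : CochainComplex C ℤ, IsBddComplex K →
      (∃ N : ℕ, ∀ m : ℤ, (N : ℤ) ≤ |m| →
        (∀ f : DerivedCategory.Q.obj K ⟶ (DerivedCategory.Q.obj KE)⟦m⟧, f = 0) ∧
        (∀ g : DerivedCategory.Q.obj KE ⟶ (DerivedCategory.Q.obj K)⟦m⟧, g = 0)) ∧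
      (∀ m : ℤ, ∃ (r : ℕ)
          (gen : Fin r → (DerivedCategory.Q.obj K ⟶ (DerivedCategory.Q.obj KE)⟦m⟧)),
        ∀ f, ∃ co : Fin r → k, f = ∑ t, sc (co t) (gen t)) ∧
      (∀ m : ℤ, ∃ (r : ℕ)
          (gen : Fin r → (DerivedCategory.Q.obj KE ⟶ (DerivedCategory.Q.obj K)⟦m⟧)),
        ∀ f, ∃ co : Fin r → k, f = ∑ t, sc (co t) (gen t)))
    -- (S2): `⨁ₙ Hom^n(E, E) ≅ k[x]/(x²)` with `x` of degree `d`: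
    (hvanish : ∀ m : ℤ, m ≠ 0 → m ≠ (d : ℤ) →
      ∀ φ : DerivedCategory.Q.obj KE ⟶ (DerivedCategory.Q.obj KE)⟦m⟧, φ = 0)
    (hspan_d : ∀ φ : DerivedCategory.Q.obj KE ⟶ (DerivedCategory.Q.obj KE)⟦(d : ℤ)⟧,
      ∃ c : k, φ = sc (πx φ) x + sc c (idShift (DerivedCategory.Q.obj KE) (d : ℤ)))
    (hspan_0 : (d : ℤ) ≠ 0 →
      ∀ φ : DerivedCategory.Q.obj KE ⟶ (DerivedCategory.Q.obj KE)⟦(0 : ℤ)⟧,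
      ∃ c : k, φ = sc c (idShift (DerivedCategory.Q.obj KE) (0 : ℤ)))
    (hx2 : x ≫ (shiftFunctor (DerivedCategory C) (d : ℤ)).map x = 0)
    -- hypothesis: the pairing is non-degenerate against every projective object
    -- of `𝒞`, viewed as a complex concentrated in a single degree:
    (hproj : ∀ P : C, Projective P →
      PairingNondeg k KE (d : ℤ) πx ((CochainComplex.singleFunctor C 0).obj P)) :
    -- conclusion: the pairing is non-degenerate against every object of `D^b(𝒞)`:
    ∀ K : CochainComplex C ℤ, IsBddComplex K → PairingNondeg k KE (d : ℤ) πx K := by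
  intro K hK
  let τ : (DerivedCategory.Q.obj KE ⟶ (DerivedCategory.Q.obj KE)⟦(d : ℤ)⟧) →ₗ[k] k :=
    { toFun := πx, map_add' := hπadd, map_smul' := fun c g => by
        rw [← sc_eq_smul, hπsmul]; rfl }
  have hp : ∀ P : C, Projective P → NdAll τ ((singleFunctor C 0).obj P) :=
    fun P hP => (ndAll_iff (τ := τ) _).1 (hproj P hP)
  refine (ndAll_iff (τ := τ) K).2 ?_
  obtain ⟨p, q, hpq⟩ := hK
  refine ndAll_of_bdd (q - p + 1).toNat p q K (by omega) hpq (fun i => ?_)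
  obtain ⟨pr, m, hm⟩ := hfindim (K.X i)
  exact ndAll_single hp pr m hm

end SphericalStmt1
end
end

section
/- For the simple right A-module S_e one has Ext⁰_A(S_e, S_e) ≅ ℂ, Ext¹_A(S_e, S_e) = 0, Ext²_A(S_e, S_e) ≅ ℂ, and Ext^n_A(S_e, S_e) = 0 for all n ≥ 3. Consequently the Yoneda algebra ⨁_{n≥0} Ext^n_A(S_e, S_e) is isomorphic as a graded ℂ-algebra to ℂ[x]/(x²) with x of degree 2. -/
open CategoryTheory MulOpposite Polynomial

namespace Sl2Q

/-- Generators of the path algebra of the quiver `e ⇄ s`: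
`0 ↦ 1_e`, `1 ↦ 1_s`, `2 ↦ a : e → s`, `3 ↦ b : s → e`. -/
abbrev FA : Type := FreeAlgebra ℂ (Fin 4)

/-- The defining relations of the path algebra `ℂQ/(ba)`:
the trivial paths are orthogonal idempotents summing to `1`, the arrows are
compatible with sources and targets, and the path `e → s → e` (first `a`, then `b`,
written `b * a`) is zero. -/
inductive PathRel : FA → FA → Prop
  | idem_e : PathRel (FreeAlgebra.ι ℂ 0 * FreeAlgebra.ι ℂ 0) (FreeAlgebra.ι ℂ 0)
  | idem_s : PathRel (FreeAlgebra.ι ℂ 1 * FreeAlgebra.ι ℂ 1) (FreeAlgebra.ι ℂ 1)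
  | orth_es : PathRel (FreeAlgebra.ι ℂ 0 * FreeAlgebra.ι ℂ 1) 0
  | orth_se : PathRel (FreeAlgebra.ι ℂ 1 * FreeAlgebra.ι ℂ 0) 0
  | sum_one : PathRel (FreeAlgebra.ι ℂ 0 + FreeAlgebra.ι ℂ 1) 1
  | a_tgt : PathRel (FreeAlgebra.ι ℂ 1 * FreeAlgebra.ι ℂ 2) (FreeAlgebra.ι ℂ 2)
  | a_src : PathRel (FreeAlgebra.ι ℂ 2 * FreeAlgebra.ι ℂ 0) (FreeAlgebra.ι ℂ 2)
  | b_tgt : PathRel (FreeAlgebra.ι ℂ 0 * FreeAlgebra.ι ℂ 3) (FreeAlgebra.ι ℂ 3)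
  | b_src : PathRel (FreeAlgebra.ι ℂ 3 * FreeAlgebra.ι ℂ 1) (FreeAlgebra.ι ℂ 3)
  | ba : PathRel (FreeAlgebra.ι ℂ 3 * FreeAlgebra.ι ℂ 2) 0

/-- The path algebra `A = ℂ[e ⇄ s]/(ba)`. -/
def A : Type := RingQuot PathRel

noncomputable instance : Ring A := inferInstanceAs (Ring (RingQuot PathRel))
noncomputable instance : Algebra ℂ A := inferInstanceAs (Algebra ℂ (RingQuot PathRel))

noncomputable def toA : FreeAlgebra ℂ (Fin 4) →ₐ[ℂ] A := RingQuot.mkAlgHom ℂ PathRel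

noncomputable def gen (i : Fin 4) : A := toA (FreeAlgebra.ι ℂ i)

/-- the idempotent `1_e` -/
noncomputable def oneE : A := gen 0
/-- the idempotent `1_s` -/
noncomputable def oneS : A := gen 1
/-- the arrow `a : e → s` -/
noncomputable def arrA : A := gen 2
/-- the arrow `b : s → e` -/
noncomputable def arrB : A := gen 3
/-- the loop `ab` at `s` (first `b`, then `a`) -/
noncomputable def ab : A := arrA * arrB

lemma rel_eq {x y : FA} (h : PathRel x y) : toA x = toA y :=
  RingQuot.mkAlgHom_rel ℂ h

lemma oneS_mul_arrA : oneS * arrA = arrA := by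
  rw [oneS, arrA, gen, gen, ← map_mul]
  exact rel_eq PathRel.a_tgt

lemma oneE_mul_arrB : oneE * arrB = arrB := by
  rw [oneE, arrB, gen, gen, ← map_mul]
  exact rel_eq PathRel.b_tgt

lemma oneS_mul_ab : oneS * ab = ab := by
  rw [ab, ← mul_assoc, oneS_mul_arrA]

/-- `A` is a right module over itself, i.e. a module over `Aᵐᵒᵖ`;
scalars `ℂ` act compatibly. -/
instance : IsScalarTower ℂ Aᵐᵒᵖ A :=
  ⟨fun c r x => by
    rw [MulOpposite.smul_eq_mul_unop, MulOpposite.smul_eq_mul_unop, MulOpposite.unop_smul,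
      mul_smul_comm]⟩

instance : SMulCommClass Aᵐᵒᵖ ℂ A :=
  ⟨fun r c x => by
    rw [MulOpposite.smul_eq_mul_unop, MulOpposite.smul_eq_mul_unop, smul_mul_assoc]⟩

/-- `P u = u·A`, the right ideal generated by `u`, as a right `A`-module
(i.e. a module over `Aᵐᵒᵖ`). -/
noncomputable def P (u : A) : Submodule Aᵐᵒᵖ A := Submodule.span Aᵐᵒᵖ {u}

lemma mem_P {u z : A} (h : u * z = z) : z ∈ P u :=
  Submodule.mem_span_singleton.mpr ⟨op z, by rw [op_smul_eq_mul, h]⟩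

instance (p : Submodule Aᵐᵒᵖ A) : SMulCommClass Aᵐᵒᵖ ℂ ↥p :=
  ⟨fun r c x => Subtype.ext (smul_comm r c (x : A))⟩

instance (p : Submodule Aᵐᵒᵖ A) : IsScalarTower ℂ Aᵐᵒᵖ ↥p :=
  ⟨fun c r x => Subtype.ext (smul_assoc c r (x : A))⟩

/-- Left multiplication by `z` as a homomorphism of right `A`-modules `P u ⟶ P v`,
where `v * z = z` (i.e. `z ∈ v·A`). -/
noncomputable def lmul (u : A) {v z : A} (h : v * z = z) : ↥(P u) →ₗ[Aᵐᵒᵖ] ↥(P v) where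
  toFun x := ⟨z * (x : A), mem_P (by rw [← mul_assoc, h])⟩
  map_add' x y := Subtype.ext (by simp [mul_add])
  map_smul' r x := Subtype.ext (by
    simp [MulOpposite.smul_eq_mul_unop, mul_assoc])

end Sl2Q

namespace Sl2Q

/-- The algebra map `A → ℂ` corresponding to the vertex `e`
(sending `1_e ↦ 1` and `1_s, a, b ↦ 0`). -/
noncomputable def εe : A →ₐ[ℂ] ℂ :=
  RingQuot.liftAlgHom ℂ
    ⟨FreeAlgebra.lift ℂ (fun i => if i = 0 then (1 : ℂ) else 0), by
      rintro x y h
      induction h <;>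
        simp [FreeAlgebra.lift_ι_apply]⟩

/-- The one-dimensional simple right `A`-module concentrated at the vertex `e`:
the underlying type is `ℂ`, and `A` acts (on the right) through `εe`,
so that `1_e` acts as the identity and `1_s`, `a`, `b` act as zero. -/
def Se : Type := ℂ

noncomputable instance : AddCommGroup Se := inferInstanceAs (AddCommGroup ℂ)
noncomputable instance : Module ℂ Se := inferInstanceAs (Module ℂ ℂ)

/-- the (right) action of `A` on `Se` through `εe` -/
noncomputable instance : Module Aᵐᵒᵖ Se :=
  Module.compHom ℂ ((εe.toRingHom).fromOpposite (fun _ _ => mul_comm _ _))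

lemma Se.smul_def (r : Aᵐᵒᵖ) (c : Se) : r • c = εe (unop r) • c := rfl

end Sl2Q

namespace Sl2Q
open CategoryTheory

/-- `S_e` as an object of the category of right `A`-modules. -/
noncomputable abbrev SeM : ModuleCat.{0} Aᵐᵒᵖ := ModuleCat.of Aᵐᵒᵖ Se

/-- `Ext^n_A(M, N)` (in the category of right `A`-modules), as a `ℂ`-module. -/
noncomputable abbrev ExtA (M N : ModuleCat.{0} Aᵐᵒᵖ) (n : ℕ) : ModuleCat ℂ :=
  ((_root_.Ext ℂ (ModuleCat.{0} Aᵐᵒᵖ) n).obj (Opposite.op M)).obj N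

end Sl2Q

namespace Sl2Q
open CategoryTheory

noncomputable instance : HasDerivedCategory (ModuleCat.{0} Aᵐᵒᵖ) :=
  HasDerivedCategory.standard _
instance : HasExt.{1} (ModuleCat.{0} Aᵐᵒᵖ) := hasExt_of_hasDerivedCategory _

end Sl2Q

namespace Sl2Q

lemma ee : oneE * oneE = oneE := by
  rw [oneE, gen, ← map_mul]; exact rel_eq PathRel.idem_e
lemma ss : oneS * oneS = oneS := by
  rw [oneS, gen, ← map_mul]; exact rel_eq PathRel.idem_s
lemma es : oneE * oneS = 0 := by
  rw [oneE, oneS, gen, gen, ← map_mul, rel_eq PathRel.orth_es, map_zero]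
lemma se : oneS * oneE = 0 := by
  rw [oneE, oneS, gen, gen, ← map_mul, rel_eq PathRel.orth_se, map_zero]
lemma e_add_s : oneE + oneS = 1 := by
  rw [oneE, oneS, gen, gen, ← map_add, rel_eq PathRel.sum_one, map_one]
lemma ae : arrA * oneE = arrA := by
  rw [oneE, arrA, gen, gen, ← map_mul]; exact rel_eq PathRel.a_src
lemma bs : arrB * oneS = arrB := by
  rw [oneS, arrB, gen, gen, ← map_mul]; exact rel_eq PathRel.b_src
lemma ba0 : arrB * arrA = 0 := by
  rw [arrA, arrB, gen, gen, ← map_mul, rel_eq PathRel.ba, map_zero]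
lemma ea : oneE * arrA = 0 := by
  rw [← oneS_mul_arrA, ← mul_assoc, es, zero_mul]
lemma sb : oneS * arrB = 0 := by
  rw [← oneE_mul_arrB, ← mul_assoc, se, zero_mul]
lemma as0 : arrA * oneS = 0 := by
  rw [← ae, mul_assoc, es, mul_zero]
lemma be0 : arrB * oneE = 0 := by
  rw [← bs, mul_assoc, se, mul_zero]
lemma aa : arrA * arrA = 0 := by
  nth_rw 1 [← ae]
  rw [mul_assoc, ea, mul_zero]
lemma bb : arrB * arrB = 0 := by
  nth_rw 1 [← bs]
  rw [mul_assoc, sb, mul_zero]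

lemma e_ab : oneE * ab = 0 := by rw [ab, ← mul_assoc, ea, zero_mul]
lemma ab_e : ab * oneE = 0 := by rw [ab, mul_assoc, be0, mul_zero]
lemma ab_s : ab * oneS = ab := by rw [ab, mul_assoc, bs]
lemma a_ab : arrA * ab = 0 := by rw [ab, ← mul_assoc, aa, zero_mul]
lemma b_ab : arrB * ab = 0 := by rw [ab, ← mul_assoc, ba0, zero_mul]
lemma ab_a : ab * arrA = 0 := by rw [ab, mul_assoc, ba0, mul_zero]
lemma ab_b : ab * arrB = 0 := by rw [ab, mul_assoc, bb, mul_zero]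
lemma ab_ab : ab * ab = 0 := by rw [ab, mul_assoc, ← ab, b_ab, mul_zero]
lemma a_b : arrA * arrB = ab := rfl

/-- linear combination of the standard basis of paths -/
noncomputable def comb (c : Fin 5 → ℂ) : A :=
  c 0 • oneE + c 1 • oneS + c 2 • arrA + c 3 • arrB + c 4 • ab

lemma comb_mul (c d : Fin 5 → ℂ) : comb c * comb d =
    comb ![c 0 * d 0, c 1 * d 1, c 1 * d 2 + c 2 * d 0, c 0 * d 3 + c 3 * d 1,
      c 1 * d 4 + c 4 * d 1 + c 2 * d 3] := by
  simp only [comb, add_mul, mul_add, smul_mul_smul_comm, ee, ss, es, se, ae, bs, ba0, ea, sb, as0,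
    be0, aa, bb, e_ab, ab_e, ab_s, a_ab, b_ab, ab_a, ab_b, ab_ab, a_b, oneS_mul_arrA, oneE_mul_arrB,
    oneS_mul_ab, smul_zero]
  simp only [Matrix.cons_val, add_smul]
  abel

lemma exists_comb (x : A) : ∃ c, x = comb c := by
  obtain ⟨y, rfl⟩ : ∃ y, toA y = x := RingQuot.mkAlgHom_surjective ℂ PathRel x
  induction y using FreeAlgebra.induction with
  | grade0 r =>
    refine ⟨![r, r, 0, 0, 0], ?_⟩
    rw [AlgHom.commutes, Algebra.algebraMap_eq_smul_one, ← e_add_s]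
    simp [comb]
  | grade1 i =>
    fin_cases i
    · exact ⟨![1, 0, 0, 0, 0], by simp [comb, oneE, gen]⟩
    · exact ⟨![0, 1, 0, 0, 0], by simp [comb, oneS, gen]⟩
    · exact ⟨![0, 0, 1, 0, 0], by simp [comb, arrA, gen]⟩
    · exact ⟨![0, 0, 0, 1, 0], by simp [comb, arrB, gen]⟩
  | mul a b ha hb =>
    obtain ⟨c, hc⟩ := ha
    obtain ⟨d, hd⟩ := hb
    exact ⟨_, by rw [map_mul, hc, hd, comb_mul]⟩
  | add a b ha hb =>
    obtain ⟨c, hc⟩ := ha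
    obtain ⟨d, hd⟩ := hb
    refine ⟨c + d, ?_⟩
    rw [map_add, hc, hd]
    simp only [comb, Pi.add_apply, add_smul]
    abel

/-- a faithful three-dimensional representation -/
noncomputable def rho : A →ₐ[ℂ] Matrix (Fin 3) (Fin 3) ℂ :=
  RingQuot.liftAlgHom ℂ
    ⟨FreeAlgebra.lift ℂ ![!![0,0,0;0,1,0;0,0,0], !![1,0,0;0,0,0;0,0,1],
      !![0,1,0;0,0,0;0,0,0], !![0,0,0;0,0,1;0,0,0]], by
      rintro x y h
      induction h <;>
        (simp only [map_mul, map_add, map_zero, map_one, FreeAlgebra.lift_ι_apply]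
         ext i j
         fin_cases i <;> fin_cases j <;> simp [Matrix.mul_apply, Fin.sum_univ_three])⟩

lemma rho_gen (i : Fin 4) : rho (gen i) = ![!![0,0,0;0,1,0;0,0,0], !![1,0,0;0,0,0;0,0,1],
      !![0,1,0;0,0,0;0,0,0], !![0,0,0;0,0,1;0,0,0]] i := by
  have : rho (gen i) = FreeAlgebra.lift ℂ ![!![0,0,0;0,1,0;0,0,0], !![1,0,0;0,0,0;0,0,1],
      !![0,1,0;0,0,0;0,0,0], !![0,0,0;0,0,1;0,0,0]] (FreeAlgebra.ι ℂ i) :=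
    RingQuot.liftAlgHom_mkAlgHom_apply ℂ _ _ _
  rw [this, FreeAlgebra.lift_ι_apply]

lemma rho_comb (c : Fin 5 → ℂ) : rho (comb c) =
    !![c 1, c 2, c 4; 0, c 0, c 3; 0, 0, c 1] := by
  simp [comb, ab, oneE, oneS, arrA, arrB, rho_gen]

lemma comb_eq_zero {c : Fin 5 → ℂ} (h : comb c = 0) : c = 0 := by
  have h1 := rho_comb c
  rw [h, map_zero] at h1
  have key := fun i j => congrFun (congrFun h1 i) j
  funext i
  fin_cases i
  · simpa using (key 1 1).symm
  · simpa using (key 0 0).symm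
  · simpa using (key 0 1).symm
  · simpa using (key 1 2).symm
  · simpa using (key 0 2).symm

lemma eps_gen (i : Fin 4) : εe (gen i) = if i = 0 then 1 else 0 := by
  have : εe (gen i) = FreeAlgebra.lift ℂ (fun i : Fin 4 => if i = 0 then (1 : ℂ) else 0)
      (FreeAlgebra.ι ℂ i) :=
    RingQuot.liftAlgHom_mkAlgHom_apply ℂ _ _ _
  rw [this, FreeAlgebra.lift_ι_apply]

lemma eps_comb (c : Fin 5 → ℂ) : εe (comb c) = c 0 := by
  simp [comb, ab, oneE, oneS, arrA, arrB, eps_gen]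

lemma mem_Pe {x : A} (hx : x ∈ P oneE) : ∃ p q : ℂ, x = p • oneE + q • arrB := by
  obtain ⟨r, rfl⟩ := Submodule.mem_span_singleton.mp hx
  obtain ⟨c, hc⟩ := exists_comb (unop r)
  refine ⟨c 0, c 3, ?_⟩
  rw [MulOpposite.smul_eq_mul_unop, hc]
  simp [comb, mul_add, ee, es, ea, oneE_mul_arrB, e_ab]

lemma mem_Ps {x : A} (hx : x ∈ P oneS) : ∃ p q r : ℂ, x = p • oneS + q • arrA + r • ab := by
  obtain ⟨r, rfl⟩ := Submodule.mem_span_singleton.mp hx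
  obtain ⟨c, hc⟩ := exists_comb (unop r)
  refine ⟨c 1, c 2, c 4, ?_⟩
  rw [MulOpposite.smul_eq_mul_unop, hc]
  simp [comb, mul_add, ss, se, sb, oneS_mul_arrA, oneS_mul_ab]

lemma idem_mul {u x : A} (hu : u * u = u) (hx : x ∈ P u) : u * x = x := by
  obtain ⟨r, rfl⟩ := Submodule.mem_span_singleton.mp hx
  rw [MulOpposite.smul_eq_mul_unop, ← mul_assoc, hu]

lemma projA : Module.Projective Aᵐᵒᵖ A :=
  Module.Projective.of_equiv (M := Aᵐᵒᵖ) (N := A) (R := Aᵐᵒᵖ) (S := Aᵐᵒᵖ)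
    (σ := RingHom.id _) (σ' := RingHom.id _)
    { toFun := unop
      invFun := op
      left_inv := fun _ => rfl
      right_inv := fun _ => rfl
      map_add' := fun _ _ => rfl
      map_smul' := fun r x => by simp [MulOpposite.smul_eq_mul_unop] }

lemma projP {u : A} (hu : u * u = u) : Module.Projective Aᵐᵒᵖ (P u) := by
  have := projA
  refine Module.Projective.of_split (P u).subtype
    { toFun := fun x => ⟨u * x, mem_P (by rw [← mul_assoc, hu])⟩
      map_add' := fun x y => Subtype.ext (mul_add _ _ _)
      map_smul' := fun r x => Subtype.ext (by
        simp [MulOpposite.smul_eq_mul_unop, mul_assoc]) } ?_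
  ext x
  exact idem_mul hu x.2

/-- the augmentation -/
noncomputable def aug : ↥(P oneE) →ₗ[Aᵐᵒᵖ] Se where
  toFun x := (εe (x : A) : ℂ)
  map_add' x y := by
    change εe ((x : A) + y) = εe (x : A) + εe (y : A)
    rw [map_add]
  map_smul' r x := by
    change εe ((x : A) * unop r) = εe (unop r) * εe (x : A)
    rw [map_mul, mul_comm]

lemma aug_surj : Function.Surjective aug := fun (c : ℂ) =>
  ⟨⟨c • oneE, mem_P (by rw [mul_smul_comm, ee])⟩, by
    change εe (c • oneE) = c
    simp [oneE, eps_gen]⟩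

lemma exact0 (x : P oneE) : aug x = 0 ↔ ∃ y, lmul oneS oneE_mul_arrB y = x := by
  constructor
  · intro h
    obtain ⟨p, q, hx⟩ := mem_Pe x.2
    have h : εe (x : A) = 0 := h
    rw [hx] at h
    simp [oneE, arrB, eps_gen] at h
    refine ⟨⟨q • oneS, mem_P (by rw [mul_smul_comm, ss])⟩, Subtype.ext ?_⟩
    change arrB * (q • oneS) = x
    rw [hx, h, mul_smul_comm, bs, zero_smul, zero_add]
  · rintro ⟨y, rfl⟩
    change εe (arrB * y) = (0 : ℂ)
    rw [map_mul]
    simp [arrB, eps_gen]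

lemma exact1 (x : P oneS) : lmul oneS oneE_mul_arrB x = 0 ↔
    ∃ y, lmul oneE oneS_mul_arrA y = x := by
  constructor
  · intro h
    obtain ⟨p, q, r, hx⟩ := mem_Ps x.2
    have h : arrB * (x : A) = 0 := congrArg Subtype.val h
    rw [hx] at h
    have h2 : comb ![0, 0, 0, p, 0] = 0 := by
      rw [← h]; simp [comb, mul_add, bs, ba0, b_ab]
    have hp : p = 0 := congrFun (comb_eq_zero h2) 3
    refine ⟨⟨q • oneE + r • arrB, mem_P (by simp [mul_add, ee, oneE_mul_arrB])⟩, Subtype.ext ?_⟩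
    change arrA * (q • oneE + r • arrB) = x
    rw [hx, hp]
    simp [mul_add, ae, a_b]
  · rintro ⟨y, rfl⟩
    apply Subtype.ext
    change arrB * (arrA * y) = (0 : A)
    rw [← mul_assoc, ba0, zero_mul]

lemma inj2 : Function.Injective (lmul oneE oneS_mul_arrA) := by
  rw [injective_iff_map_eq_zero]
  intro x h
  obtain ⟨p, q, hx⟩ := mem_Pe x.2
  have h : arrA * (x : A) = 0 := congrArg Subtype.val h
  rw [hx] at h
  have h2 : comb ![0, 0, p, 0, q] = 0 := by
    rw [← h]; simp [comb, mul_add, ae, a_b]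
  have hp : p = 0 := congrFun (comb_eq_zero h2) 2
  have hq : q = 0 := congrFun (comb_eq_zero h2) 4
  apply Subtype.ext
  rw [hx, hp, hq]; simp

lemma homPs (f : P oneS →ₗ[Aᵐᵒᵖ] Se) : f = 0 := by
  ext x
  have h1 : x = op (x : A) • op oneS • (⟨oneS, mem_P ss⟩ : P oneS) := by
    apply Subtype.ext
    change (x : A) = oneS * oneS * x
    rw [ss, idem_mul ss x.2]
  have h2 : f (op oneS • (⟨oneS, mem_P ss⟩ : P oneS)) = 0 := by
    rw [map_smul, Se.smul_def (op oneS)]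
    simp [oneS, eps_gen]
  rw [h1, map_smul, h2, smul_zero]
  rfl


/-- the projective at `e` -/
noncomputable abbrev PeM : ModuleCat.{0} Aᵐᵒᵖ := ModuleCat.of Aᵐᵒᵖ (P oneE)
/-- the projective at `s` -/
noncomputable abbrev PsM : ModuleCat.{0} Aᵐᵒᵖ := ModuleCat.of Aᵐᵒᵖ (P oneS)
/-- the augmentation, as a morphism -/
noncomputable abbrev augM : PeM ⟶ SeM := ModuleCat.ofHom aug

lemma homPe (f : PeM ⟶ SeM) : ∃ c : ℂ, c • augM = f := by
  refine ⟨(f.hom ⟨oneE, mem_P ee⟩ : ℂ), ?_⟩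
  ext x
  have h1 : x = op (x : A) • (⟨oneE, mem_P ee⟩ : P oneE) := by
    apply Subtype.ext
    change (x : A) = oneE * x
    rw [idem_mul ee x.2]
  have h2 : f.hom x = f.hom (op (x : A) • (⟨oneE, mem_P ee⟩ : P oneE)) := congrArg _ h1
  rw [h2, map_smul, Se.smul_def]
  have key : ∀ c : ℂ, εe (algebraMap ℂ A c) * εe (x : A) = εe (x : A) * c := fun c => by
    rw [AlgHom.commutes, mul_comm]
    rfl
  exact key _

lemma augM_ne : augM ≠ 0 := by
  intro h
  have h1 : augM.hom ⟨oneE, mem_P ee⟩ = (0 : PeM ⟶ SeM).hom ⟨oneE, mem_P ee⟩ := by rw [h]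
  have h2 : εe oneE = (0 : ℂ) := h1
  simp [oneE, eps_gen] at h2

lemma homPs' (f : PsM ⟶ SeM) : f = 0 := ModuleCat.hom_ext (homPs f.hom)

end Sl2Q
namespace Sl2Q
open CategoryTheory Limits

section generic
universe w v u
variable {C : Type u} [Category.{v} C] [Abelian C]
  {P0 P1 P2 Z : C} [Projective P0] [Projective P1] [Projective P2]
  (d1 : P1 ⟶ P0) (d2 : P2 ⟶ P1) (p : P0 ⟶ Z) (h1 : d1 ≫ p = 0) (h2 : d2 ≫ d1 = 0)

open ZeroObject

/-- objects of the length two complex -/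
noncomputable def rX (P0 P1 P2 : C) : ℕ → C
  | 0 => P0
  | 1 => P1
  | 2 => P2
  | _ + 3 => 0

/-- differentials of the length two complex -/
noncomputable def rd : ∀ n, rX P0 P1 P2 (n + 1) ⟶ rX P0 P1 P2 n
  | 0 => d1
  | 1 => d2
  | _ + 2 => 0

include h2 in
lemma rd_sq : ∀ n, rd d1 d2 (n + 1) ≫ rd d1 d2 n = 0
  | 0 => h2
  | _ + 1 => Limits.zero_comp

/-- the length two complex -/
noncomputable def rC : ChainComplex C ℕ := ChainComplex.of (rX P0 P1 P2) (rd d1 d2) (rd_sq d1 d2 h2)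

lemma rC_d (n : ℕ) : (rC d1 d2 h2).d (n + 1) n = rd d1 d2 n := ChainComplex.of_d _ _ _

/-- the length two resolution -/
noncomputable def res [Epi p] [Mono d2] (e0 : (ShortComplex.mk d1 p h1).Exact)
    (e1 : (ShortComplex.mk d2 d1 h2).Exact) : ProjectiveResolution Z where
  complex := rC d1 d2 h2
  projective n := by
    match n with
    | 0 => exact inferInstanceAs (Projective P0)
    | 1 => exact inferInstanceAs (Projective P1)
    | 2 => exact inferInstanceAs (Projective P2)
    | _ + 3 => exact inferInstanceAs (Projective (0 : C))
  π := (ChainComplex.toSingle₀Equiv _ _).symm ⟨p, by rw [rC_d]; exact h1⟩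
  quasiIso := ⟨fun n => by
    cases n with
    | zero =>
      rw [ChainComplex.quasiIsoAt₀_iff, ShortComplex.quasiIso_iff_of_zeros' _ rfl rfl rfl]
      refine (ShortComplex.exact_and_epi_g_iff_of_iso ?_).2 ⟨e0, ‹Epi p›⟩
      refine ShortComplex.isoMk (Iso.refl _) (Iso.refl _) (Iso.refl _) ?_ ?_
      · have := rC_d d1 d2 h2 0
        exact (Category.id_comp _).trans (this.symm.trans (Category.comp_id _).symm)
      · have := ChainComplex.toSingle₀Equiv_symm_apply_f_zero (C := rC d1 d2 h2) p
          (by rw [rC_d]; exact h1)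
        exact (Category.id_comp _).trans (this.symm.trans (Category.comp_id _).symm)
    | succ n =>
      rw [quasiIsoAt_iff_exactAt' (hL := ChainComplex.exactAt_succ_single_obj ..),
        HomologicalComplex.exactAt_iff' _ (n + 2) (n + 1) n (by simp) (by simp)]
      have key : (ShortComplex.mk (rd d1 d2 (n + 1)) (rd d1 d2 n) (rd_sq d1 d2 h2 n)).Exact := by
        match n with
        | 0 => exact e1
        | 1 => exact (ShortComplex.exact_iff_mono _ rfl).2 ‹Mono d2›
        | n + 2 => exact ShortComplex.exact_of_isZero_X₂ _ (isZero_zero C)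
      refine (ShortComplex.exact_iff_of_iso ?_).2 key
      refine ShortComplex.isoMk (Iso.refl _) (Iso.refl _) (Iso.refl _) ?_ ?_
      · have := rC_d d1 d2 h2 (n + 1)
        exact (Category.id_comp _).trans (this.symm.trans (Category.comp_id _).symm)
      · have := rC_d d1 d2 h2 n
        exact (Category.id_comp _).trans (this.symm.trans (Category.comp_id _).symm)⟩

lemma sq_zero [HasExt.{w} C] {Y : C} [Epi p] [Mono d2] (e0 : (ShortComplex.mk d1 p h1).Exact)
    (e1 : (ShortComplex.mk d2 d1 h2).Exact) (hY : ∀ f : P1 ⟶ Y, f = 0) (g : P2 ⟶ Y) (hg : g ≠ 0) :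
    (∃ ξ : Abelian.Ext Z Y 2, ξ ≠ 0) ∧ HasProjectiveDimensionLT Z 3 := by
  have s1 : (ShortComplex.mk (kernel.ι p) p (kernel.condition p)).ShortExact :=
    { exact := ShortComplex.exact_kernel p }
  let q : P1 ⟶ kernel p := kernel.lift p d1 h1
  have hq : Epi q := e0.epi_kernelLift
  have hqi : q ≫ kernel.ι p = d1 := kernel.lift_ι _ _ _
  have hd2q : d2 ≫ q = 0 := by
    rw [← cancel_mono (kernel.ι p), Category.assoc, hqi, h2, Limits.zero_comp]
  have s2 : (ShortComplex.mk d2 q hd2q).ShortExact :=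
    { exact := by
        let φ : ShortComplex.mk d2 q hd2q ⟶ ShortComplex.mk d2 d1 h2 :=
          { τ₁ := 𝟙 _, τ₂ := 𝟙 _, τ₃ := kernel.ι p }
        have : Epi φ.τ₁ := inferInstanceAs (Epi (𝟙 _))
        have : IsIso φ.τ₂ := inferInstanceAs (IsIso (𝟙 _))
        have : Mono φ.τ₃ := inferInstanceAs (Mono (kernel.ι p))
        exact (ShortComplex.exact_iff_of_epi_of_isIso_of_mono φ).2 e1 }
  constructor
  · refine ⟨s1.extClass.comp (s2.extClass.comp (Abelian.Ext.mk₀ g) (add_zero 1)) rfl, fun h => ?_⟩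
    obtain ⟨x, hx⟩ := Abelian.Ext.contravariant_sequence_exact₁ s1 _ _ rfl h
    have hx0 : x = 0 := Abelian.Ext.eq_zero_of_projective (P := P0) x
    rw [hx0, Abelian.Ext.comp_zero] at hx
    obtain ⟨y, hy⟩ := Abelian.Ext.contravariant_sequence_exact₁ s2 _ _ _ hx.symm
    obtain ⟨f, rfl⟩ := (Abelian.Ext.mk₀_bijective _ _).2 y
    obtain rfl := hY f
    rw [Abelian.Ext.mk₀_zero, Abelian.Ext.comp_zero] at hy
    exact hg ((Abelian.Ext.mk₀_eq_zero_iff _).1 hy.symm)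
  · have k : HasProjectiveDimensionLT (kernel p) 2 :=
      s2.hasProjectiveDimensionLT_X₃ 1 (inferInstanceAs (HasProjectiveDimensionLT P2 1))
        (inferInstanceAs (HasProjectiveDimensionLT P1 2))
    exact s1.hasProjectiveDimensionLT_X₃ 2 k (inferInstanceAs (HasProjectiveDimensionLT P0 3))

variable {R : Type*} [Ring R] [Linear R C] [EnoughProjectives C]

lemma ext_sub {Y : C} (Q : ProjectiveResolution Z) (n : ℕ) (h : ∀ f : Q.complex.X n ⟶ Y, f = 0) :
    Subsingleton (((_root_.Ext R C n).obj (Opposite.op Z)).obj Y) := by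
  refine ModuleCat.subsingleton_of_isZero (IsZero.of_iso ?_ (Q.isoExt n Y))
  rw [← HomologicalComplex.exactAt_iff_isZero_homology, HomologicalComplex.exactAt_iff]
  refine ShortComplex.exact_of_isZero_X₂ _ ?_
  rw [IsZero.iff_id_eq_zero]
  ext (x : _ ⟶ _)
  obtain rfl : x = 0 := h x
  rfl

lemma ext_iso {Y : C} (Q : ProjectiveResolution Z) (n : ℕ)
    (h : ∀ f : Q.complex.X (n + 1) ⟶ Y, f = 0)
    (h' : ∀ m, m + 1 = n → ∀ f : Q.complex.X m ⟶ Y, f = 0) :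
    Nonempty (((_root_.Ext R C n).obj (Opposite.op Z)).obj Y ≃ₗ[R] (Q.complex.X n ⟶ Y)) := by
  let K := Q.complex.linearYonedaObj R Y
  have k1 : K.d n (n + 1) = 0 := by
    ext (x : _ ⟶ _)
    exact h _
  have k2 : K.d ((ComplexShape.up ℕ).prev n) n = 0 := by
    cases n with
    | zero => simp
    | succ m =>
      ext (x : _ ⟶ _)
      have : x = 0 := by
        have e : (ComplexShape.up ℕ).prev (m + 1) = m := by simp
        revert x
        rw [e]
        exact h' m rfl
      subst this
      exact map_zero _
  have i := Q.isoExt (R := R) n Y ≪≫ (K.isoHomologyπ _ n rfl k2).symm ≪≫ K.iCyclesIso n (n + 1) (by simp) k1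
  exact ⟨i.toLinearEquiv⟩

end generic
end Sl2Q
namespace Sl2Q
open CategoryTheory

lemma finrank_hom : Module.finrank ℂ (PeM ⟶ SeM) = 1 :=
  finrank_eq_one augM augM_ne homPe


/-- `Ext⁰_A(S_e, S_e) ≅ ℂ`, `Ext¹_A(S_e, S_e) = 0`,
`Ext²_A(S_e, S_e) ≅ ℂ` and `Ext^n_A(S_e, S_e) = 0` for `n ≥ 3`; consequently the
Yoneda algebra `⨁ₙ Ext^n_A(S_e, S_e)` is `ℂ[x]/(x²)` with `x` of degree `2`
(there is a nonzero class `ξ` of degree `2`, unique up to scalars, whose Yoneda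
square vanishes). -/
theorem ext_Se_Se_yoneda_algebra :
    Module.finrank ℂ (ExtA SeM SeM 0) = 1 ∧
    Subsingleton (ExtA SeM SeM 1) ∧
    Module.finrank ℂ (ExtA SeM SeM 2) = 1 ∧
    (∀ n : ℕ, 3 ≤ n → Subsingleton (ExtA SeM SeM n)) ∧
    ∃ ξ : Abelian.Ext SeM SeM 2, ξ ≠ 0 ∧
      ξ.comp ξ (by norm_num) = (0 : Abelian.Ext SeM SeM 4) := by
  have := projP ee
  have := projP ss
  have pe : Projective PeM := inferInstance
  have ps : Projective PsM := inferInstance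
  let d1 : PsM ⟶ PeM := ModuleCat.ofHom (lmul oneS oneE_mul_arrB)
  let d2 : PeM ⟶ PsM := ModuleCat.ofHom (lmul oneE oneS_mul_arrA)
  have h1 : d1 ≫ augM = 0 := by
    ext x
    exact (exact0 _).2 ⟨x, rfl⟩
  have h2 : d2 ≫ d1 = 0 := by
    ext x
    exact congrArg Subtype.val ((exact1 _).2 ⟨x, rfl⟩)
  have e0 : (ShortComplex.mk d1 augM h1).Exact :=
    (ShortComplex.moduleCat_exact_iff _).2 fun x hx => (exact0 x).1 hx
  have e1 : (ShortComplex.mk d2 d1 h2).Exact :=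
    (ShortComplex.moduleCat_exact_iff _).2 fun x hx => (exact1 x).1 hx
  have : Epi augM := (ModuleCat.epi_iff_surjective _).2 aug_surj
  have : Mono d2 := (ModuleCat.mono_iff_injective _).2 inj2
  let Q := res d1 d2 augM h1 h2 e0 e1
  have q1 : ∀ f : Q.complex.X 1 ⟶ SeM, f = 0 := homPs'
  have q3 : ∀ n, ∀ f : Q.complex.X (n + 3) ⟶ SeM, f = 0 := fun n f =>
    (Limits.isZero_zero (ModuleCat.{0} Aᵐᵒᵖ)).eq_of_src _ _
  obtain ⟨⟨ξ, hξ⟩, hd⟩ := sq_zero d1 d2 augM h1 h2 e0 e1 homPs' augM augM_ne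
  refine ⟨?_, ext_sub Q 1 q1, ?_, ?_, ξ, hξ, ?_⟩
  · obtain ⟨i⟩ := ext_iso (R := ℂ) Q 0 q1 (by simp)
    exact i.finrank_eq.trans finrank_hom
  · obtain ⟨i⟩ := ext_iso (R := ℂ) Q 2 (q3 0) (by
      rintro m hm
      obtain rfl : m = 1 := by omega
      exact q1)
    exact i.finrank_eq.trans finrank_hom
  · intro n hn
    obtain ⟨m, rfl⟩ := Nat.exists_eq_add_of_le' hn
    exact ext_sub Q _ (q3 m)
  · exact Abelian.Ext.eq_zero_of_hasProjectiveDimensionLT _ 3 (by norm_num)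

end Sl2Q
end
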